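/- arXiv:2201.10400 — 3 statements merged into one kernel-verified Lean document; each statement's English description precedes it below -/
import Mathlib

section
/- Fix n ≥ 2. For g ∈ SL(n,ℝ) let Ad_g denote the linear map X ↦ gXg⁻¹ on the space of traceless real n×n matrices, and let ‖Ad_g‖ be its operator norm with respect to the Frobenius inner product ⟨X,Y⟩ = tr(XYᵀ). For ρ ≥ 1 set B_ρ := { g ∈ SL(n,ℝ) : ‖Ad_g‖ ≤ ρ }. Then: (a) g ∈ B_ρ if and only if g⁻¹ ∈ B_ρ; (b) if g ∈ B_ρ and k, k' ∈ SO(n) then k·g·k' ∈ B_ρ; (c) ⋃_{ρ ≥ 1} B_ρ = SL(n,ℝ); and (d) ⋂_{ρ > 1} B_ρ = SO(n) (viewed as a subset of SL(n,ℝ)). -/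
open Matrix

/-- The ball `B_ρ = { g ∈ SL(n,ℝ) : ‖Ad_g‖ ≤ ρ }`, where `Ad_g X = g X g⁻¹` acts on the
traceless real `n × n` matrices and the operator norm is taken with respect to the
Frobenius norm `‖X‖ = sqrt(tr (X Xᵀ)) = sqrt(Σ_{i,j} X_{ij}²)`; membership is expressed
through the defining property `‖Ad_g X‖ ≤ ρ ‖X‖` for all traceless `X`. -/
def adjointBall (n : ℕ) (ρ : ℝ) : Set (Matrix.SpecialLinearGroup (Fin n) ℝ) :=
  {g | ∀ X : Matrix (Fin n) (Fin n) ℝ, Matrix.trace X = 0 →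
    Real.sqrt (∑ i, ∑ j,
        (((g : Matrix (Fin n) (Fin n) ℝ) * X * ((g⁻¹ : Matrix.SpecialLinearGroup (Fin n) ℝ) :
          Matrix (Fin n) (Fin n) ℝ)) i j) ^ 2)
      ≤ ρ * Real.sqrt (∑ i, ∑ j, (X i j) ^ 2)}

section AdjointBall

open scoped Matrix.Norms.Frobenius

variable {n : ℕ}

lemma sqrt_sum_sq_eq_frobenius_norm (X : Matrix (Fin n) (Fin n) ℝ) :
    Real.sqrt (∑ i, ∑ j, (X i j) ^ 2) = ‖X‖ := by
  rw [frobenius_norm_def, Real.sqrt_eq_rpow]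
  simp

lemma frobenius_norm_sq_eq_trace (X : Matrix (Fin n) (Fin n) ℝ) :
    ‖X‖ ^ 2 = trace (X * Xᵀ) := by
  rw [← sqrt_sum_sq_eq_frobenius_norm, Real.sq_sqrt (by positivity)]
  simp [trace, mul_apply, sq]

lemma trace_mul_transpose_le_frobenius_norm_mul (X Y : Matrix (Fin n) (Fin n) ℝ) :
    trace (X * Yᵀ) ≤ ‖X‖ * ‖Y‖ := by
  have h := Real.sum_mul_le_sqrt_mul_sqrt (Finset.univ : Finset (Fin n × Fin n))
    (fun p => X p.1 p.2) (fun p => Y p.1 p.2)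
  simp only [Fintype.sum_prod_type, sqrt_sum_sq_eq_frobenius_norm] at h
  simpa [trace, mul_apply] using h

lemma mem_adjointBall_iff {ρ : ℝ} {g : SpecialLinearGroup (Fin n) ℝ} :
    g ∈ adjointBall n ρ ↔ ∀ X : Matrix (Fin n) (Fin n) ℝ, trace X = 0 →
      ‖g.1 * X * (g⁻¹).1‖ ≤ ρ * ‖X‖ := by
  simp only [adjointBall, Set.mem_ofPred_eq, sqrt_sum_sq_eq_frobenius_norm]

lemma SpecialLinearGroup.coe_mul_coe_inv (g : SpecialLinearGroup (Fin n) ℝ) :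
    g.1 * (g⁻¹).1 = 1 := by
  exact congrArg Subtype.val (mul_inv_cancel g)

lemma SpecialLinearGroup.coe_inv_mul_coe (g : SpecialLinearGroup (Fin n) ℝ) :
    (g⁻¹).1 * g.1 = 1 := by
  exact congrArg Subtype.val (inv_mul_cancel g)

lemma SpecialLinearGroup.trace_conj (g : SpecialLinearGroup (Fin n) ℝ)
    (X : Matrix (Fin n) (Fin n) ℝ) : trace (g.1 * X * (g⁻¹).1) = trace X := by
  rw [trace_mul_comm, ← mul_assoc, SpecialLinearGroup.coe_inv_mul_coe, one_mul]

/-- Conjugation by `g⁻¹` is, up to transposition, the Frobenius adjoint of conjugation by `g`. -/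
lemma inv_mem_adjointBall {ρ : ℝ} {g : SpecialLinearGroup (Fin n) ℝ}
    (hg : g ∈ adjointBall n ρ) : g⁻¹ ∈ adjointBall n ρ := by
  rw [mem_adjointBall_iff] at hg ⊢
  intro X hX
  rw [inv_inv]
  set Y := (g⁻¹).1 * X * g.1 with hY
  have hYt : trace Yᵀ = 0 := by
    rw [trace_transpose, hY]
    simpa [hX] using SpecialLinearGroup.trace_conj g⁻¹ X
  have hsq : ‖Y‖ ^ 2 = trace ((g.1 * Yᵀ * (g⁻¹).1) * Xᵀᵀ) := by
    rw [frobenius_norm_sq_eq_trace, transpose_transpose]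
    calc trace (Y * Yᵀ) = trace ((g⁻¹).1 * X * (g.1 * Yᵀ)) := by
          rw [← mul_assoc, ← hY]
      _ = trace (g.1 * Yᵀ * (g⁻¹).1 * X) := by
          rw [trace_mul_comm, ← mul_assoc]
  have hle : ‖Y‖ ^ 2 ≤ ρ * ‖Y‖ * ‖X‖ := by
    rw [hsq]
    refine (trace_mul_transpose_le_frobenius_norm_mul _ _).trans ?_
    have h := hg Yᵀ hYt
    rw [frobenius_norm_transpose] at h
    rw [frobenius_norm_transpose]
    gcongr
  rcases (norm_nonneg Y).eq_or_lt with h0 | hpos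
  · have h := hg X hX
    rw [← h0]
    exact (norm_nonneg _).trans h
  · nlinarith

lemma frobenius_norm_conj_of_orthogonal {k : SpecialLinearGroup (Fin n) ℝ}
    (hk : k.1ᵀ * k.1 = 1) (X : Matrix (Fin n) (Fin n) ℝ) :
    ‖k.1 * X * (k⁻¹).1‖ = ‖X‖ := by
  have hinv : (k⁻¹).1 = k.1ᵀ :=
    (left_inv_eq_right_inv hk (SpecialLinearGroup.coe_mul_coe_inv k)).symm
  rw [← sq_eq_sq₀ (norm_nonneg _) (norm_nonneg _), frobenius_norm_sq_eq_trace,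
    frobenius_norm_sq_eq_trace, hinv]
  calc trace (k.1 * X * k.1ᵀ * (k.1 * X * k.1ᵀ)ᵀ)
      = trace (k.1 * (X * (k.1ᵀ * k.1) * Xᵀ * k.1ᵀ)) := by
        simp only [transpose_mul, transpose_transpose, mul_assoc]
    _ = trace (X * Xᵀ) := by
        rw [trace_mul_comm, hk, mul_one, mul_assoc, hk, mul_one]

lemma mul_mul_mem_adjointBall {ρ : ℝ} {g k k' : SpecialLinearGroup (Fin n) ℝ}
    (hg : g ∈ adjointBall n ρ) (hk : k.1ᵀ * k.1 = 1) (hk' : k'.1ᵀ * k'.1 = 1) :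
    k * g * k' ∈ adjointBall n ρ := by
  rw [mem_adjointBall_iff] at hg ⊢
  intro X hX
  have heq : (k * g * k').1 * X * ((k * g * k')⁻¹).1 =
      k.1 * (g.1 * (k'.1 * X * (k'⁻¹).1) * (g⁻¹).1) * (k⁻¹).1 := by
    rw [_root_.mul_inv_rev, _root_.mul_inv_rev]
    change k.1 * g.1 * k'.1 * X * ((k'⁻¹).1 * ((g⁻¹).1 * (k⁻¹).1)) = _
    simp only [mul_assoc]
  rw [heq, frobenius_norm_conj_of_orthogonal hk, ← frobenius_norm_conj_of_orthogonal hk' X]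
  exact hg _ ((SpecialLinearGroup.trace_conj k' X).trans hX)

lemma exists_one_le_mem_adjointBall (g : SpecialLinearGroup (Fin n) ℝ) :
    ∃ ρ : ℝ, 1 ≤ ρ ∧ g ∈ adjointBall n ρ := by
  refine ⟨max 1 (‖g.1‖ * ‖(g⁻¹).1‖), le_max_left _ _, mem_adjointBall_iff.2 ?_⟩
  intro X _
  calc ‖g.1 * X * (g⁻¹).1‖ ≤ ‖g.1‖ * ‖X‖ * ‖(g⁻¹).1‖ :=
        (frobenius_norm_mul _ _).trans (by gcongr; exact frobenius_norm_mul _ _)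
    _ = ‖g.1‖ * ‖(g⁻¹).1‖ * ‖X‖ := by ring
    _ ≤ _ := by gcongr; exact le_max_right _ _

lemma mem_adjointBall_of_orthogonal {k : SpecialLinearGroup (Fin n) ℝ}
    (hk : k.1ᵀ * k.1 = 1) {ρ : ℝ} (hρ : 1 ≤ ρ) : k ∈ adjointBall n ρ := by
  rw [mem_adjointBall_iff]
  intro X _
  rw [frobenius_norm_conj_of_orthogonal hk]
  exact le_mul_of_one_le_left (norm_nonneg _) hρ

lemma mem_adjointBall_one_of_forall {g : SpecialLinearGroup (Fin n) ℝ}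
    (hg : ∀ ρ : ℝ, 1 < ρ → g ∈ adjointBall n ρ) : g ∈ adjointBall n 1 := by
  rw [mem_adjointBall_iff]
  intro X hX
  have hc : ContinuousWithinAt (fun ρ : ℝ => ρ * ‖X‖) (Set.Ioi 1) 1 := by fun_prop
  refine ge_of_tendsto hc ?_
  filter_upwards [self_mem_nhdsWithin] with ρ hρ
  exact mem_adjointBall_iff.1 (hg ρ hρ) X hX

/-- If conjugation by `g` is a Frobenius contraction on traceless matrices, then so are its inverse
and its adjoint, which forces it to be an isometry. -/
lemma commute_transpose_mul_of_mem_adjointBall_one {g : SpecialLinearGroup (Fin n) ℝ}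
    (hg : g ∈ adjointBall n 1) {X : Matrix (Fin n) (Fin n) ℝ} (hX : trace X = 0) :
    Commute X (g.1ᵀ * g.1) := by
  have hg' := mem_adjointBall_iff.1 (inv_mem_adjointBall hg)
  rw [mem_adjointBall_iff] at hg
  simp only [one_mul, inv_inv] at hg hg'
  have h1 := SpecialLinearGroup.coe_mul_coe_inv g
  have h2 := SpecialLinearGroup.coe_inv_mul_coe g
  set a := g.1
  set b := (g⁻¹).1
  set Y := a * X * b with hY
  have hYt : trace Y = 0 := (SpecialLinearGroup.trace_conj g X).trans hX
  set Z := aᵀ * Y * bᵀ with hZ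
  have hZY : ‖Z‖ ≤ ‖Y‖ := by
    have h := hg' Yᵀ (by rw [trace_transpose, hYt])
    rw [← frobenius_norm_transpose, frobenius_norm_transpose Y] at h
    simpa only [transpose_mul, transpose_transpose, ← mul_assoc] using h
  have hXY : ‖X‖ ≤ ‖Y‖ := by
    have h := hg' Y hYt
    have hbYa : b * Y * a = X := by
      calc b * Y * a = (b * a) * X * (b * a) := by simp only [hY, mul_assoc]
        _ = X := by rw [h2, one_mul, mul_one]
    rwa [hbYa] at h
  have hinner : trace (Z * Xᵀ) = ‖Y‖ ^ 2 := by
    rw [frobenius_norm_sq_eq_trace]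
    calc trace (Z * Xᵀ) = trace (aᵀ * (Y * bᵀ * Xᵀ)) := by simp only [hZ, mul_assoc]
      _ = trace (Y * Yᵀ) := by
        rw [trace_mul_comm]
        simp only [hY, transpose_mul, mul_assoc]
  have hinner' : trace (X * Zᵀ) = ‖Y‖ ^ 2 := by
    rw [← hinner, ← trace_transpose, transpose_mul, transpose_transpose]
  have hdiff : ‖Z - X‖ ^ 2 = ‖Z‖ ^ 2 - 2 * ‖Y‖ ^ 2 + ‖X‖ ^ 2 := by
    rw [frobenius_norm_sq_eq_trace (Z - X), transpose_sub, sub_mul, mul_sub, mul_sub, trace_sub,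
      trace_sub, trace_sub, hinner, hinner', ← frobenius_norm_sq_eq_trace,
      ← frobenius_norm_sq_eq_trace]
    ring
  have hZX : Z = X := by
    rw [← sub_eq_zero, ← norm_eq_zero]
    have hZ2 : ‖Z‖ ^ 2 ≤ ‖Y‖ ^ 2 := by gcongr
    have hX2 : ‖X‖ ^ 2 ≤ ‖Y‖ ^ 2 := by gcongr
    nlinarith [sq_nonneg ‖Z - X‖]
  have hba : bᵀ * aᵀ = 1 := by rw [← transpose_mul, h1, transpose_one]
  calc X * (aᵀ * a) = Z * (aᵀ * a) := by rw [hZX]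
    _ = aᵀ * a * X * b * (bᵀ * aᵀ) * a := by simp only [hZ, hY, mul_assoc]
    _ = aᵀ * a * X := by rw [hba, mul_one, mul_assoc _ b a, h2, mul_one]

lemma transpose_mul_eq_one_of_mem_adjointBall_one (hn : n ≠ 0)
    {g : SpecialLinearGroup (Fin n) ℝ} (hg : g ∈ adjointBall n 1) : g.1ᵀ * g.1 = 1 := by
  obtain ⟨c, hc⟩ := mem_range_scalar_of_commute_single (M := g.1ᵀ * g.1) fun i j hij =>
    commute_transpose_mul_of_mem_adjointBall_one hg (trace_single_eq_of_ne i j 1 hij)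
  have hdet : c ^ n = 1 := by
    have h := congrArg det hc
    rw [det_mul, det_transpose, g.2] at h
    simpa using h
  have hc0 : 0 ≤ c := by
    have h := congrFun (congrFun hc ⟨0, Nat.pos_of_ne_zero hn⟩) ⟨0, Nat.pos_of_ne_zero hn⟩
    rw [mul_apply] at h
    simp only [scalar_apply, diagonal_apply_eq, transpose_apply] at h
    rw [h]
    exact Finset.sum_nonneg fun i _ => mul_self_nonneg _
  rw [← hc, (pow_eq_one_iff_of_nonneg hc0 hn).1 hdet, map_one]

end AdjointBall

/-- Proposition 8.2 of the paper for `G = SL(n,ℝ)`, `K = SO(n)`: the balls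
`B_ρ = {g : ‖Ad_g‖ ≤ ρ}` are (a) invariant under inversion, (b) invariant under left and
right multiplication by `SO(n)` (elements `k` of `SL(n,ℝ)` with `kᵀ k = 1`), (c) their
union over `ρ ≥ 1` is all of `SL(n,ℝ)`, and (d) their intersection over `ρ > 1` is
exactly `SO(n)`. -/
theorem adjointBall_invariance_union_intersection (n : ℕ) (hn : 2 ≤ n) :
    (∀ ρ : ℝ, 1 ≤ ρ → ∀ g : Matrix.SpecialLinearGroup (Fin n) ℝ,
        g ∈ adjointBall n ρ ↔ g⁻¹ ∈ adjointBall n ρ) ∧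
      (∀ ρ : ℝ, 1 ≤ ρ → ∀ g k k' : Matrix.SpecialLinearGroup (Fin n) ℝ,
        g ∈ adjointBall n ρ →
        (k : Matrix (Fin n) (Fin n) ℝ)ᵀ * (k : Matrix (Fin n) (Fin n) ℝ) = 1 →
        (k' : Matrix (Fin n) (Fin n) ℝ)ᵀ * (k' : Matrix (Fin n) (Fin n) ℝ) = 1 →
        k * g * k' ∈ adjointBall n ρ) ∧
      (⋃ ρ : ℝ, ⋃ (_ : 1 ≤ ρ), adjointBall n ρ) = Set.univ ∧
      (⋂ ρ : ℝ, ⋂ (_ : 1 < ρ), adjointBall n ρ) =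
        {k : Matrix.SpecialLinearGroup (Fin n) ℝ |
          (k : Matrix (Fin n) (Fin n) ℝ)ᵀ * (k : Matrix (Fin n) (Fin n) ℝ) = 1} := by
  refine ⟨fun ρ _ g => ⟨inv_mem_adjointBall, fun h => inv_inv g ▸ inv_mem_adjointBall h⟩,
    fun ρ _ g k k' hg hk hk' => mul_mul_mem_adjointBall hg hk hk', ?_, ?_⟩
  · refine Set.eq_univ_of_forall fun g => ?_
    obtain ⟨ρ, hρ, hg⟩ := exists_one_le_mem_adjointBall g
    exact Set.mem_iUnion₂.2 ⟨ρ, hρ, hg⟩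
  · ext g
    rw [Set.mem_iInter₂, Set.mem_ofPred_eq]
    exact ⟨fun h => transpose_mul_eq_one_of_mem_adjointBall_one (by lia)
      (mem_adjointBall_one_of_forall h), fun h ρ hρ => mem_adjointBall_of_orthogonal h hρ.le⟩
end

section
/- Let V be a finite-dimensional real normed vector space, let C ⊆ V be a nonempty open convex cone (i.e. C is open, convex, and t·v ∈ C for all t > 0 and v ∈ C), and let m ∈ ℕ. Let u : V → ℝ be a function that is (m+1)-times continuously differentiable on the closure of C (in the sense of ContDiffOn on closure(C)) and whose iterated derivatives within closure(C) of every order k ≤ m−1 vanish at 0. Then for every compact set K ⊆ closure(C), the functions v ↦ ε^{−m} · u(ε·v) converge, uniformly for v ∈ K as ε → 0⁺, to the function v ↦ (1/m!) · D^m u(0)[v, …, v], where D^m u(0) denotes the m-th iterated derivative of u at 0 within closure(C). -/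
open Filter
open scoped Topology

/-- Iterated derivatives of a function along the ray spanned by `v`. -/
theorem iteratedDerivWithin_comp_smul_const {V F : Type*} [NormedAddCommGroup V] [NormedSpace ℝ V]
    [NormedAddCommGroup F] [NormedSpace ℝ F] {f : V → F} {s : Set V} {n : WithTop ℕ∞}
    (hf : ContDiffOn ℝ n f s) (hs : UniqueDiffOn ℝ s) {T : Set ℝ} (hT : UniqueDiffOn ℝ T) {v : V}
    (hTs : ∀ t ∈ T, t • v ∈ s) {i : ℕ} (hi : i ≤ n) {t : ℝ} (ht : t ∈ T) :
    iteratedDerivWithin i (fun r : ℝ => f (r • v)) T t =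
      iteratedFDerivWithin ℝ i f s (t • v) (fun _ => v) := by
  have key := ((((hf.of_le hi).ftaylorSeriesWithin hs).compContinuousLinearMap
    (ContinuousLinearMap.toSpanSingleton ℝ v)).mono
      (t := T) (fun r hr => by simpa using hTs r hr)).eq_iteratedFDerivWithin_of_uniqueDiffOn
        le_rfl hT ht
  have hcomp : f ∘ ContinuousLinearMap.toSpanSingleton ℝ v = fun r : ℝ => f (r • v) := by
    ext r
    simp
  rw [hcomp] at key
  rw [iteratedDerivWithin_eq_iteratedFDerivWithin, ← key]
  simp [ftaylorSeriesWithin]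

/-- Taylor's formula with remainder bound along the segment from `0` to `v`, for a function whose
derivatives of order `< m` vanish at `0`. -/
theorem norm_sub_taylor_leading_term_le {V F : Type*} [NormedAddCommGroup V] [NormedSpace ℝ V]
    [NormedAddCommGroup F] [NormedSpace ℝ F] {f : V → F} {s : Set V} {m : ℕ}
    (hf : ContDiffOn ℝ (m + 1 : ℕ) f s) (hs : UniqueDiffOn ℝ s)
    (hvanish : ∀ k < m, iteratedFDerivWithin ℝ k f s 0 = 0) {v : V}
    (hv : ∀ t ∈ Set.Icc (0 : ℝ) 1, t • v ∈ s) {B : ℝ}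
    (hB : ∀ t ∈ Set.Icc (0 : ℝ) 1,
      ‖iteratedFDerivWithin ℝ (m + 1) f s (t • v) (fun _ => v)‖ ≤ B)
    {ε : ℝ} (hε : ε ∈ Set.Icc (0 : ℝ) 1) :
    ‖f (ε • v) - ((m.factorial : ℝ)⁻¹ * ε ^ m) • iteratedFDerivWithin ℝ m f s 0 (fun _ => v)‖ ≤
      B * ε ^ (m + 1) / m.factorial := by
  have hT : UniqueDiffOn ℝ (Set.Icc (0 : ℝ) 1) := uniqueDiffOn_Icc zero_lt_one
  have h0 : (0 : ℝ) ∈ Set.Icc (0 : ℝ) 1 := by simp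
  have hcd : ContDiffOn ℝ (m + 1) (fun r : ℝ => f (r • v)) (Set.Icc 0 1) := by
    exact_mod_cast hf.comp (contDiff_id.smul contDiff_const).contDiffOn hv
  have hderiv : ∀ k ≤ m + 1, ∀ t ∈ Set.Icc (0 : ℝ) 1,
      iteratedDerivWithin k (fun r : ℝ => f (r • v)) (Set.Icc 0 1) t =
        iteratedFDerivWithin ℝ k f s (t • v) (fun _ => v) := fun k hk t ht =>
    iteratedDerivWithin_comp_smul_const hf hs hT hv (by exact_mod_cast hk) ht
  have hbound := taylor_mean_remainder_bound zero_le_one hcd hε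
    (fun t ht => (hderiv (m + 1) le_rfl t ht).symm ▸ hB t ht)
  have htaylor : taylorWithinEval (fun r : ℝ => f (r • v)) m (Set.Icc 0 1) 0 ε =
      ((m.factorial : ℝ)⁻¹ * ε ^ m) • iteratedFDerivWithin ℝ m f s 0 (fun _ => v) := by
    rw [taylor_within_apply, Finset.sum_range_succ, Finset.sum_eq_zero, hderiv m m.le_succ 0 h0]
    · simp
    · intro k hk
      have hk := Finset.mem_range.1 hk
      rw [hderiv k (by lia) 0 h0, zero_smul, hvanish k hk]
      simp
  simpa [htaylor] using hbound

/-- The unnumbered proposition of Section 9 of the paper: if `C` is a nonempty open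
convex cone in a finite-dimensional real normed space, and `u` is `(m+1)`-times
continuously differentiable on `closure C` with all iterated derivatives (within
`closure C`) of order `< m` vanishing at `0`, then `ε^{-m} u(ε v) → (1/m!) D^m u(0)[v,…,v]`
uniformly for `v` in any compact subset of `closure C`, as `ε → 0⁺`. -/
theorem taylor_uniform_scaling_limit
    {V : Type*} [NormedAddCommGroup V] [NormedSpace ℝ V] [FiniteDimensional ℝ V]
    (C : Set V) (hC_ne : C.Nonempty) (hC_open : IsOpen C) (hC_conv : Convex ℝ C)
    (hC_cone : ∀ t : ℝ, 0 < t → ∀ v ∈ C, t • v ∈ C)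
    (m : ℕ) (u : V → ℝ)
    (hu : ContDiffOn ℝ (m + 1 : ℕ) u (closure C))
    (hvanish : ∀ k : ℕ, k < m → iteratedFDerivWithin ℝ k u (closure C) 0 = 0) :
    ∀ K : Set V, IsCompact K → K ⊆ closure C →
      TendstoUniformlyOn
        (fun (ε : ℝ) (v : V) => (ε ^ m)⁻¹ * u (ε • v))
        (fun v => ((m.factorial : ℝ))⁻¹ * iteratedFDerivWithin ℝ m u (closure C) 0 (fun _ => v))
        (𝓝[>] (0 : ℝ)) K := by
  intro K hK hKC
  have hs : UniqueDiffOn ℝ (closure C) :=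
    uniqueDiffOn_convex hC_conv.closure
      (hC_ne.mono (hC_open.subset_interior_iff.2 subset_closure))
  have hcone : ∀ t : ℝ, 0 ≤ t → ∀ v ∈ closure C, t • v ∈ closure C := fun t ht v hv =>
    map_mem_closure₂ (s := Set.Ioi 0) continuous_smul (by rwa [closure_Ioi, Set.mem_Ici]) hv
      hC_cone
  obtain ⟨B, hB⟩ : ∃ B : ℝ, ∀ p ∈ Set.Icc (0 : ℝ) 1 ×ˢ K,
      ‖iteratedFDerivWithin ℝ (m + 1) u (closure C) (p.1 • p.2) (fun _ => p.2)‖ ≤ B := by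
    refine (isCompact_Icc.prod hK).exists_bound_of_continuousOn ?_
    have hcont : ContinuousOn (fun p : ℝ × V =>
        iteratedFDerivWithin ℝ (m + 1) u (closure C) (p.1 • p.2)) (Set.Icc (0 : ℝ) 1 ×ˢ K) :=
      (hu.continuousOn_iteratedFDerivWithin le_rfl hs).comp continuous_smul.continuousOn
        (fun p hp => hcone p.1 hp.1.1 p.2 (hKC hp.2))
    exact hcont.eval (by fun_prop)
  rw [Metric.tendstoUniformlyOn_iff]
  intro δ hδ
  have hlim : Tendsto (fun ε : ℝ => B / m.factorial * ε) (𝓝[>] 0) (𝓝 0) := by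
    have h : Tendsto (fun ε : ℝ => B / m.factorial * ε) (𝓝 0) (𝓝 (B / m.factorial * 0)) :=
      (continuous_const.mul continuous_id).tendsto 0
    rw [mul_zero] at h
    exact h.mono_left nhdsWithin_le_nhds
  filter_upwards [hlim.eventually_lt_const hδ, Ioc_mem_nhdsGT zero_lt_one] with ε hεδ hε v hv
  have hpos : 0 < ε ^ m := pow_pos hε.1 m
  have hmain := norm_sub_taylor_leading_term_le hu hs hvanish
    (fun t ht => hcone t ht.1 v (hKC hv)) (fun t ht => hB (t, v) ⟨ht, hv⟩) ⟨hε.1.le, hε.2⟩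
  refine lt_of_le_of_lt ?_ hεδ
  rw [dist_comm, dist_eq_norm]
  refine le_of_mul_le_mul_left ?_ hpos
  rw [smul_eq_mul] at hmain
  calc _ = ‖ε ^ m * ((ε ^ m)⁻¹ * u (ε • v) - (m.factorial : ℝ)⁻¹ *
          iteratedFDerivWithin ℝ m u (closure C) 0 (fun _ => v))‖ := by
        rw [norm_mul, Real.norm_of_nonneg hpos.le]
    _ = _ := by
      rw [mul_sub, mul_inv_cancel_left₀ hpos.ne', ← mul_assoc, mul_comm (ε ^ m)]
    _ ≤ _ := hmain
    _ = _ := by ring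
end

section
/- Let 𝔤 be a finite-dimensional real Lie algebra with Killing form κ, and let θ : 𝔤 → 𝔤 be a Lie algebra automorphism with θ ∘ θ = id such that the bilinear form B_θ(x,y) := −κ(x, θ(y)) is a positive-definite inner product on 𝔤 (a Cartan involution). Let 𝔥 ⊆ 𝔤 be a Cartan subalgebra with θ(𝔥) = 𝔥. Then for every ε > 0, the set { y ∈ 𝔤 : y ∈ 𝔥, and y = φ(x) for some Lie algebra automorphism φ of 𝔤 and some x ∈ 𝔤 with B_θ(x,x) ≤ ε² } is bounded in 𝔤. -/
/-- In a `CStarRing`, a normal element satisfies `‖a ^ n‖ = ‖a‖ ^ n` for `n` a power of two. -/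
theorem norm_pow_two_pow_of_isStarNormal {A : Type*} [NormedRing A] [StarRing A] [CStarRing A]
    (a : A) [IsStarNormal a] (k : ℕ) : ‖a ^ 2 ^ k‖ = ‖a‖ ^ 2 ^ k := by
  have h : ‖(star a * a) ^ 2 ^ k‖ = ‖star a * a‖ ^ 2 ^ k :=
    (IsSelfAdjoint.star_mul_self a).norm_pow_two_pow k
  rw [Commute.mul_pow (star_comm_self' a), ← star_pow, CStarRing.norm_star_mul_self,
    CStarRing.norm_star_mul_self, mul_pow] at h
  exact (mul_self_inj (norm_nonneg _) (by positivity)).mp h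

/-- A normal element of a `CStarRing` has the smallest norm in its similarity class. -/
theorem norm_le_of_isStarNormal_conj {A : Type*} [NormedRing A] [StarRing A] [CStarRing A]
    {a x : A} [IsStarNormal a] (u : Aˣ) (h : a = u * x * ↑u⁻¹) : ‖a‖ ≤ ‖x‖ := by
  by_contra! hlt
  have ha : 0 < ‖a‖ := (norm_nonneg x).trans_lt hlt
  set C : ℝ := ‖(u : A)‖ * ‖(↑u⁻¹ : A)‖
  have key (k : ℕ) : 1 ≤ C * (‖x‖ / ‖a‖) ^ 2 ^ k := by
    rw [div_pow, ← mul_div_assoc, le_div_iff₀ (by positivity), one_mul,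
      ← norm_pow_two_pow_of_isStarNormal, h, Units.conj_pow]
    calc ‖(u : A) * x ^ 2 ^ k * ↑u⁻¹‖ ≤ ‖(u : A)‖ * ‖x ^ 2 ^ k‖ * ‖(↑u⁻¹ : A)‖ := norm_mul₃_le
      _ ≤ ‖(u : A)‖ * ‖x‖ ^ 2 ^ k * ‖(↑u⁻¹ : A)‖ := by
        gcongr
        exact norm_pow_le' x (by positivity)
      _ = C * ‖x‖ ^ 2 ^ k := by ring
  have hlim : Filter.Tendsto (fun k : ℕ => C * (‖x‖ / ‖a‖) ^ 2 ^ k) Filter.atTop (nhds (C * 0)) :=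
    ((tendsto_pow_atTop_nhds_zero_of_lt_one (by positivity) ((div_lt_one ha).mpr hlt)).comp
      (tendsto_pow_atTop_atTop_of_one_lt one_lt_two)).const_mul C
  have := ge_of_tendsto' hlim key
  norm_num at this

/-- Given an injective linear family `f` of endomorphisms of a Euclidean space, if `f y` is normal
and conjugate to `f x`, then the norm of `y` is controlled by that of `x`. -/
theorem exists_norm_le_of_isStarNormal_conj {V : Type*} [NormedAddCommGroup V]
    [InnerProductSpace ℝ V] [FiniteDimensional ℝ V] (f : V →ₗ[ℝ] Module.End ℝ V)
    (hf : Function.Injective f) :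
    ∃ K : ℝ, 0 ≤ K ∧ ∀ x y : V, (∃ T : Module.End ℝ V, Commute (f y) T ∧
        ∀ u v : V, inner ℝ (f y u) v = inner ℝ u (T v)) →
      (∃ φ : V ≃ₗ[ℝ] V, f y = φ.conj (f x)) → ‖y‖ ≤ K * ‖x‖ := by
  have := FiniteDimensional.complete ℝ V
  let F : V →ₗ[ℝ] V →L[ℝ] V := LinearMap.toContinuousLinearMap.toLinearMap ∘ₗ f
  obtain ⟨K, -, hK⟩ := F.exists_antilipschitzWith
    (LinearMap.ker_eq_bot.mpr (LinearMap.toContinuousLinearMap.injective.comp hf))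
  refine ⟨K * ‖F.toContinuousLinearMap‖, by positivity, ?_⟩
  rintro x y ⟨T, hT, hadj⟩ ⟨φ, hφ⟩
  have hstar : F y = star (LinearMap.toContinuousLinearMap T) :=
    (ContinuousLinearMap.eq_adjoint_iff _ _).mpr hadj
  have : IsStarNormal (F y) := by
    refine ⟨?_⟩
    rw [hstar, star_star, ← hstar]
    ext v
    exact (LinearMap.congr_fun hT.eq v).symm
  let u : (V →L[ℝ] V)ˣ :=
    { val := φ.toContinuousLinearEquiv
      inv := φ.symm.toContinuousLinearEquiv
      val_inv := by ext v; exact φ.apply_symm_apply v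
      inv_val := by ext v; exact φ.symm_apply_apply v }
  have hu : F y = u * F x * ↑u⁻¹ := by
    ext v
    exact LinearMap.congr_fun hφ v
  calc ‖y‖ ≤ K * ‖F y‖ := ZeroHomClass.bound_of_antilipschitz F hK y
    _ ≤ K * ‖F x‖ := by gcongr; exact norm_le_of_isStarNormal_conj u hu
    _ ≤ K * (‖F.toContinuousLinearMap‖ * ‖x‖) := by
      gcongr; exact F.toContinuousLinearMap.le_opNorm x
    _ = K * ‖F.toContinuousLinearMap‖ * ‖x‖ := by ring

/-- Version of `exists_norm_le_of_isStarNormal_conj` for a positive definite bilinear form. -/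
theorem LinearMap.BilinForm.exists_apply_self_le_of_normal_conj {V : Type*} [AddCommGroup V]
    [Module ℝ V] [Module.Finite ℝ V] (B : LinearMap.BilinForm ℝ V) (hsymm : ∀ x y, B x y = B y x)
    (hpos : ∀ x, x ≠ 0 → 0 < B x x) (f : V →ₗ[ℝ] Module.End ℝ V) (hf : Function.Injective f) :
    ∃ K : ℝ, 0 ≤ K ∧ ∀ x y : V, (∃ T : Module.End ℝ V, Commute (f y) T ∧
        ∀ u v : V, B (f y u) v = B u (T v)) →
      (∃ φ : V ≃ₗ[ℝ] V, f y = φ.conj (f x)) → B y y ≤ K * B x x := by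
  let core : InnerProductSpace.Core ℝ V :=
    { inner := fun x y => B x y
      conj_inner_symm := fun x y => hsymm y x
      re_inner_nonneg := fun x => by
        rcases eq_or_ne x 0 with rfl | hx
        · simp
        · exact (hpos x hx).le
      add_left := fun x y z => by simp
      smul_left := fun x y r => by simp
      definite := fun x hx => by
        by_contra h
        exact (hpos x h).ne' hx }
  let : NormedAddCommGroup V := core.toNormedAddCommGroup
  let : InnerProductSpace ℝ V := InnerProductSpace.ofCore core.toCore
  have hnorm (x : V) : B x x = ‖x‖ ^ 2 := real_inner_self_eq_norm_sq x
  obtain ⟨K, hK, h⟩ := exists_norm_le_of_isStarNormal_conj f hf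
  refine ⟨K ^ 2, by positivity, fun x y hT hφ => ?_⟩
  rw [hnorm, hnorm, ← mul_pow]
  exact pow_le_pow_left₀ (norm_nonneg y) (h x y hT hφ) 2


/-- Lemma 10.10 of the paper (`lem:VepsIsCompact`): let `𝔤` be a finite-dimensional real
Lie algebra, `θ` an involutive automorphism such that `B_θ(x,y) := −κ(x, θ y)` is positive
definite (a Cartan involution), and `𝔥` a `θ`-invariant Cartan subalgebra.  Then for every
`ε > 0` the set of elements of `𝔥` lying in the image, under some Lie algebra
automorphism, of the `B_θ`-ball of radius `ε`, is bounded (in the `B_θ`-norm). -/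
theorem automorphism_saturation_inter_cartan_bounded
    {L : Type*} [LieRing L] [LieAlgebra ℝ L] [Module.Finite ℝ L]
    (θ : L ≃ₗ⁅ℝ⁆ L) (hθ : ∀ x : L, θ (θ x) = x)
    (hpos : ∀ x : L, x ≠ 0 → 0 < -(killingForm ℝ L x (θ x)))
    (H : LieSubalgebra ℝ L) (hH : H.IsCartanSubalgebra)
    (hθH : (fun y => θ y) '' (H : Set L) = (H : Set L))
    (ε : ℝ) (hε : 0 < ε) :
    ∃ M : ℝ, ∀ y : L, y ∈ H →
      (∃ (φ : L ≃ₗ⁅ℝ⁆ L) (x : L), -(killingForm ℝ L x (θ x)) ≤ ε ^ 2 ∧ y = φ x) →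
      -(killingForm ℝ L y (θ y)) ≤ M := by
  have hK (x y : L) : killingForm ℝ L x (θ y) = killingForm ℝ L (θ x) y := by
    rw [← LieAlgebra.killingForm_of_equiv_apply θ x (θ y), hθ]
  have hker (x : L) (hx : ∀ y, killingForm ℝ L y x = 0) : x = 0 := by
    by_contra h
    have := hpos x h
    rw [hK, hx] at this
    simp at this
  have : LieAlgebra.IsKilling ℝ L := by
    refine ⟨(LieSubmodule.eq_bot_iff _).mpr fun x hx => hker x fun y => ?_⟩
    exact (LieIdeal.mem_killingCompl ℝ L ⊤).mp hx y (LieSubmodule.mem_top y)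
  let B : LinearMap.BilinForm ℝ L := -(killingForm ℝ L).compl₂ (θ : L →ₗ[ℝ] L)
  have hB (x y : L) : B x y = -(killingForm ℝ L x (θ y)) := rfl
  have had : Function.Injective (LieAlgebra.ad ℝ L : L →ₗ[ℝ] Module.End ℝ L) := by
    refine (injective_iff_map_eq_zero _).mpr fun x hx => hker x fun y => ?_
    have hx' : LieAlgebra.ad ℝ L x = 0 := hx
    rw [killingForm_apply_apply, hx']
    simp
  obtain ⟨K, hK0, hbound⟩ := B.exists_apply_self_le_of_normal_conj
    (fun x y => by rw [hB, hB, hK, LieModule.traceForm_comm]) hpos _ had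
  refine ⟨K * ε ^ 2, ?_⟩
  rintro y hy ⟨φ, x, hx, rfl⟩
  refine (hbound x (φ x) ⟨-LieAlgebra.ad ℝ L (θ (φ x)), ?_, fun u v => ?_⟩
    ⟨φ.toLinearEquiv, (LieAlgebra.conj_ad_apply φ x).symm⟩).trans
      (mul_le_mul_of_nonneg_left hx hK0)
  · have hθy : θ (φ x) ∈ H := by
      rw [← SetLike.mem_coe, ← hθH]
      exact ⟨φ x, hy, rfl⟩
    have hcomm : ⁅φ x, θ (φ x)⁆ = 0 :=
      congrArg Subtype.val (trivial_lie_zero H H ⟨φ x, hy⟩ ⟨θ (φ x), hθy⟩)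
    refine Commute.neg_right ?_
    refine LinearMap.ext fun v => ?_
    change ⁅φ x, ⁅θ (φ x), v⁆⁆ = ⁅θ (φ x), ⁅φ x, v⁆⁆
    rw [leibniz_lie, hcomm, zero_lie, zero_add]
  · change B ⁅φ x, u⁆ v = B u (-⁅θ (φ x), v⁆)
    rw [hB, hB, LieModule.traceForm_apply_lie_apply', map_neg, LieEquiv.map_lie, hθ, map_neg]
end
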